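/- For a cusp form f of even weight k ≥ 4 with exponential decay at i∞ and at 0, the Eichler integral F(z) = ∫_{i∞}^{z} f(τ)(τ − z)^{k-2} dτ satisfies F(−1/z) z^{k-2} − F(z) = r_f(z), where r_f(z) = ∫_0^{i∞} f(τ)(τ − z)^{k-2} dτ. -/

import Mathlib

open Complex MeasureTheory Set
open Filter Topology

/-- A holomorphic function on the upper half-plane has a primitive there. -/
theorem exists_hasDerivAt_of_differentiableOn_upperHalfPlane {g : ℂ → ℂ}
    (hg : DifferentiableOn ℂ g {τ : ℂ | 0 < τ.im}) :
    ∃ G : ℂ → ℂ, ∀ τ : ℂ, 0 < τ.im → HasDerivAt G (g τ) τ := by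
  have hsq : ∀ w : ℂ, w ∈ Metric.ball (0 : ℂ) 1 → w.re * w.re + w.im * w.im < 1 := by
    intro w hw
    rw [mem_ball_zero_iff] at hw
    rw [← Complex.normSq_apply, Complex.normSq_eq_norm_sq]
    nlinarith [norm_nonneg w]
  have hne : ∀ w : ℂ, w ∈ Metric.ball (0 : ℂ) 1 → 1 - w ≠ 0 := by
    intro w hw h
    have := hsq w hw
    rw [← sub_eq_zero.mp h] at this
    norm_num at this
  have hmaps : MapsTo (fun w : ℂ => I * ((1 + w) / (1 - w))) (Metric.ball 0 1)
      {τ : ℂ | 0 < τ.im} := by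
    intro w hw
    have h1 := hsq w hw
    have h2 : 0 < normSq (1 - w) := normSq_pos.mpr (hne w hw)
    have h3 : (I * ((1 + w) / (1 - w))).im
        = (1 - (w.re * w.re + w.im * w.im)) / normSq (1 - w) := by
      simp [Complex.div_re]
      ring
    rw [mem_ofPred_eq, h3]
    exact div_pos (by linarith) h2
  have hdiff : DifferentiableOn ℂ
      (fun w : ℂ => g (I * ((1 + w) / (1 - w))) * (2 * I / (1 - w) ^ 2)) (Metric.ball 0 1) := by
    refine (hg.comp ?_ hmaps).mul ?_
    · exact fun w hw => (by fun_prop (disch := exact hne w hw) :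
        DifferentiableAt ℂ (fun w : ℂ => I * ((1 + w) / (1 - w))) w).differentiableWithinAt
    · exact fun w hw => (by fun_prop (disch := exact pow_ne_zero 2 (hne w hw)) :
        DifferentiableAt ℂ (fun w : ℂ => 2 * I / (1 - w) ^ 2) w).differentiableWithinAt
  obtain ⟨Q, hQ⟩ := hdiff.isExactOn_ball
  refine ⟨fun τ => Q ((τ - I) / (τ + I)), fun τ hτ => ?_⟩
  have hτI : τ + I ≠ 0 := fun h => by
    have := congrArg Complex.im h
    simp at this
    linarith
  have hball : (τ - I) / (τ + I) ∈ Metric.ball (0 : ℂ) 1 := by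
    rw [mem_ball_zero_iff, norm_div, div_lt_one (norm_pos_iff.mpr hτI),
      ← sq_lt_sq₀ (norm_nonneg _) (norm_nonneg _), ← Complex.normSq_eq_norm_sq,
      ← Complex.normSq_eq_norm_sq, Complex.normSq_apply, Complex.normSq_apply]
    simp
    nlinarith
  have hw : HasDerivAt (fun τ : ℂ => (τ - I) / (τ + I)) (2 * I / (τ + I) ^ 2) τ := by
    convert! ((hasDerivAt_id τ).sub_const I).div ((hasDerivAt_id τ).add_const I) hτI using 1
    simp
    ring
  have h1 : 1 - (τ - I) / (τ + I) = 2 * I / (τ + I) := by field_simp; ring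
  have h2 : I * ((1 + (τ - I) / (τ + I)) / (1 - (τ - I) / (τ + I))) = τ := by
    rw [h1]; field_simp; ring
  have h3 := (hQ _ hball).comp τ hw
  beta_reduce at h3
  rw [h2, h1] at h3
  convert! h3 using 1
  have : I ^ 2 = -1 := I_sq
  field_simp

/-- Exponential decay at `i∞` bounds `f(τ)(aτ+b)^n` uniformly on `Im τ ≥ T`, `‖τ‖ ≤ R + T`. -/
theorem exists_norm_mul_pow_le {f : ℂ → ℂ} {c C : ℝ} (hc : 0 < c)
    (hf : ∀ τ : ℂ, 1 ≤ τ.im → ‖f τ‖ ≤ C * Real.exp (-c * τ.im)) (a b : ℂ) (n : ℕ) (R : ℝ) :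
    ∃ β : ℝ → ℝ, (β =O[atTop] fun T => Real.exp (-(c / 2) * T)) ∧
      ∀ (T : ℝ) (τ : ℂ), 1 ≤ T → T ≤ τ.im → ‖τ‖ ≤ R + T → ‖f τ * (a * τ + b) ^ n‖ ≤ β T := by
  have hC : 0 ≤ C := by
    have := (norm_nonneg _).trans (hf I (by simp))
    exact nonneg_of_mul_nonneg_left this (Real.exp_pos _)
  refine ⟨fun T => C * Real.exp (-c * T) * (‖a‖ * (R + T) + ‖b‖) ^ n, ?_, ?_⟩
  · have h1 : (fun T : ℝ => ‖a‖ * (R + T) + ‖b‖) =O[atTop] fun T : ℝ => T := by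
      have hconst : ∀ x : ℝ, (fun _ : ℝ => x) =O[atTop] fun T : ℝ => T := fun x =>
        (Asymptotics.isLittleO_const_id_atTop x).isBigO
      exact (((hconst R).add (Asymptotics.isBigO_refl _ _)).const_mul_left _).add (hconst _)
    have h2 := (h1.pow n).trans (isLittleO_pow_exp_pos_mul_atTop n (half_pos hc)).isBigO
    have h3 := ((Asymptotics.isBigO_refl (fun T : ℝ => Real.exp (-c * T)) atTop).const_mul_left
      C).mul h2
    refine h3.congr_right fun T => ?_
    rw [← Real.exp_add]
    ring_nf
  · intro T τ h1 h2 h3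
    rw [norm_mul, norm_pow]
    have h4 : ‖a * τ + b‖ ≤ ‖a‖ * (R + T) + ‖b‖ := by
      refine (norm_add_le _ _).trans ?_
      rw [norm_mul]
      gcongr
    have h5 : ‖f τ‖ ≤ C * Real.exp (-c * T) := by
      refine (hf τ (h1.trans h2)).trans (mul_le_mul_of_nonneg_left (Real.exp_le_exp.mpr ?_) hC)
      nlinarith
    exact mul_le_mul h5 (pow_le_pow_left₀ (norm_nonneg _) h4 n) (by positivity) (by positivity)

theorem isBigO_vertical {f : ℂ → ℂ} {c C : ℝ} (hc : 0 < c)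
    (hf : ∀ τ : ℂ, 1 ≤ τ.im → ‖f τ‖ ≤ C * Real.exp (-c * τ.im)) (a b : ℂ) (n : ℕ) {w : ℂ}
    (hw : 0 ≤ w.im) :
    (fun t : ℝ => f (w + t * I) * (a * (w + t * I) + b) ^ n * I) =O[atTop]
      fun t => Real.exp (-(c / 2) * t) := by
  obtain ⟨β, hβ, hle⟩ := exists_norm_mul_pow_le hc hf a b n ‖w‖
  refine Asymptotics.IsBigO.trans (Asymptotics.IsBigO.of_bound 1 ?_) hβ
  filter_upwards [eventually_ge_atTop 1] with t ht
  rw [norm_mul, norm_I, mul_one, one_mul]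
  refine (hle t _ ht ?_ ?_).trans (le_abs_self _)
  · simpa using hw
  · refine (norm_add_le _ _).trans ?_
    simp [abs_of_nonneg (zero_le_one.trans ht)]

theorem integrableOn_vertical {f : ℂ → ℂ} {c C : ℝ} (hc : 0 < c)
    (hhol : DifferentiableOn ℂ f {τ : ℂ | 0 < τ.im})
    (hf : ∀ τ : ℂ, 1 ≤ τ.im → ‖f τ‖ ≤ C * Real.exp (-c * τ.im)) (a b : ℂ) (n : ℕ) {w : ℂ}
    (hw : 0 ≤ w.im) {s : ℝ} (hs : 0 < w.im + s) :
    IntegrableOn (fun t : ℝ => f (w + t * I) * (a * (w + t * I) + b) ^ n * I) (Ioi s) := by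
  rw [← integrableOn_Ici_iff_integrableOn_Ioi]
  have hcont : ContinuousOn (fun t : ℝ => f (w + t * I) * (a * (w + t * I) + b) ^ n * I)
      (Ici s) := by
    refine ((hhol.continuousOn.comp (by fun_prop) fun t ht => ?_).mul (by fun_prop)).mul
      (by fun_prop)
    have : s ≤ t := ht
    simp
    linarith
  exact (hcont.locallyIntegrableOn measurableSet_Ici).integrableOn_of_isBigO_atTop
    (isBigO_vertical hc hf a b n hw)
    ⟨Ioi 0, Ioi_mem_atTop 0, exp_neg_integrableOn_Ioi 0 (half_pos hc)⟩

theorem hasDerivAt_vertical {G g : ℂ → ℂ} (hG : ∀ τ : ℂ, 0 < τ.im → HasDerivAt G (g τ) τ)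
    {w : ℂ} {t : ℝ} (ht : 0 < w.im + t) :
    HasDerivAt (fun t : ℝ => G (w + t * I)) (g (w + t * I) * I) t := by
  have h1 : HasDerivAt (fun t : ℝ => w + t * I) I t := by
    simpa using ((hasDerivAt_id t).ofReal_comp.mul_const I).const_add w
  exact (hG (w + t * I) (by simpa using ht)).comp t h1

/-- A primitive of `f(τ)(aτ+b)^n`, where `f` decays exponentially at `i∞`, has a limit at `i∞`
which is the same along all vertical lines. -/
theorem exists_tendsto_vertical {f G : ℂ → ℂ} {c C : ℝ} (hc : 0 < c)
    (hhol : DifferentiableOn ℂ f {τ : ℂ | 0 < τ.im})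
    (hf : ∀ τ : ℂ, 1 ≤ τ.im → ‖f τ‖ ≤ C * Real.exp (-c * τ.im)) {a b : ℂ} {n : ℕ}
    (hG : ∀ τ : ℂ, 0 < τ.im → HasDerivAt G (f τ * (a * τ + b) ^ n) τ) :
    ∃ L : ℂ, ∀ w : ℂ, 0 ≤ w.im → Tendsto (fun t : ℝ => G (w + t * I)) atTop (𝓝 L) := by
  have h0 := tendsto_limUnder_of_hasDerivAt_of_integrableOn_Ioi (a := 1)
    (fun t (ht : 1 < t) => hasDerivAt_vertical hG (w := 0) (t := t) (by simp; linarith))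
    (integrableOn_vertical hc hhol hf a b n (w := 0) le_rfl (by simp))
  refine ⟨limUnder atTop fun t : ℝ => G (0 + t * I), fun w hw => ?_⟩
  obtain ⟨β, hβ, hle⟩ := exists_norm_mul_pow_le hc hf a b n ‖w‖
  have hexp : Tendsto (fun T : ℝ => Real.exp (-(c / 2) * T)) atTop (𝓝 0) :=
    Real.tendsto_exp_atBot.comp (tendsto_id.const_mul_atTop_of_neg (by linarith))
  have hβ0 : Tendsto (fun T => β T * ‖w‖) atTop (𝓝 0) := by
    simpa using (hβ.trans_tendsto hexp).mul_const ‖w‖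
  have hdiff : Tendsto (fun t : ℝ => G (w + t * I) - G (0 + t * I)) atTop (𝓝 0) := by
    refine squeeze_zero_norm' ?_ hβ0
    filter_upwards [eventually_ge_atTop 1] with t ht
    let s : Set ℂ := {τ | t ≤ τ.im} ∩ Metric.closedBall (t * I) ‖w‖
    have hs : Convex ℝ s := (convex_halfSpace_im_ge t).inter (convex_closedBall _ _)
    have key := hs.norm_image_sub_le_of_norm_hasDerivWithin_le (f := G) (C := β t)
      (x := 0 + t * I) (y := w + t * I)
      (fun τ hτ => (hG τ (by have : t ≤ τ.im := hτ.1; linarith)).hasDerivWithinAt)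
      (fun τ hτ => hle t τ ht hτ.1 ?_) ⟨by simp, by simp⟩ ⟨by simpa using hw, by simp⟩
    · simpa using key
    · have h1 : ‖τ - t * I‖ ≤ ‖w‖ := by simpa [dist_eq_norm] using hτ.2
      have h2 : ‖(t * I : ℂ)‖ = t := by simp [abs_of_nonneg (zero_le_one.trans ht)]
      calc ‖τ‖ = ‖(τ - t * I) + t * I‖ := by ring_nf
        _ ≤ ‖τ - t * I‖ + ‖(t * I : ℂ)‖ := norm_add_le _ _
        _ ≤ ‖w‖ + t := by rw [h2]; gcongr
  simpa using hdiff.add h0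

theorem integral_vertical {f G : ℂ → ℂ} {c C : ℝ} (hc : 0 < c)
    (hhol : DifferentiableOn ℂ f {τ : ℂ | 0 < τ.im})
    (hf : ∀ τ : ℂ, 1 ≤ τ.im → ‖f τ‖ ≤ C * Real.exp (-c * τ.im)) {a b : ℂ} {n : ℕ}
    (hG : ∀ τ : ℂ, 0 < τ.im → HasDerivAt G (f τ * (a * τ + b) ^ n) τ) {L w : ℂ} (hw : 0 < w.im)
    (hL : Tendsto (fun t : ℝ => G (w + t * I)) atTop (𝓝 L)) :
    ∫ t in Ioi (0 : ℝ), f (w + t * I) * (a * (w + t * I) + b) ^ n * I = L - G w := by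
  have := integral_Ioi_of_hasDerivAt_of_tendsto'
    (fun t (ht : 0 ≤ t) => hasDerivAt_vertical hG (w := w) (t := t) (by linarith))
    (integrableOn_vertical hc hhol hf a b n hw.le (by simpa using hw)) hL
  simpa using this

/-- A modular `f` that decays exponentially at `i∞` is bounded on `(0, i]`. -/
theorem norm_le_of_modular {f : ℂ → ℂ} {c C : ℝ} (hc : 0 < c) {k : ℕ}
    (hf : ∀ τ : ℂ, 1 ≤ τ.im → ‖f τ‖ ≤ C * Real.exp (-c * τ.im))
    (hmod : ∀ τ : ℂ, 0 < τ.im → f (-1 / τ) = τ ^ k * f τ) {t : ℝ} (ht : 0 < t) (ht1 : t ≤ 1) :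
    ‖f (t * I)‖ ≤ C * (k.factorial / c ^ k) := by
  have hC : 0 ≤ C := by
    have := (norm_nonneg _).trans (hf I (by simp))
    exact nonneg_of_mul_nonneg_left this (Real.exp_pos _)
  set u : ℝ := t⁻¹ with hu
  have hu1 : 1 ≤ u := (one_le_inv₀ ht).mpr ht1
  have hu0 : 0 < u := by linarith
  have htu : (t * I : ℂ) = -1 / (u * I) := by
    have : (t : ℂ) ≠ 0 := by exact_mod_cast ht.ne'
    rw [hu]
    push_cast
    field_simp
    simp
  have h1 := hf (u * I) (by simpa using hu1)
  have h2 : u ^ k * Real.exp (-c * u) ≤ k.factorial / c ^ k := by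
    have := Real.pow_div_factorial_le_exp _ (mul_nonneg hc.le hu0.le) k
    rw [div_le_iff₀ (by positivity), mul_pow] at this
    rw [le_div_iff₀ (by positivity), neg_mul, Real.exp_neg, mul_right_comm,
      ← div_eq_mul_inv, div_le_iff₀ (Real.exp_pos _)]
    linarith
  rw [htu, hmod _ (by simpa using hu0), norm_mul, norm_pow, norm_mul, norm_I, mul_one,
    Complex.norm_real, Real.norm_of_nonneg hu0.le]
  have h3 : (u * I : ℂ).im = u := by simp
  rw [h3] at h1
  calc u ^ k * ‖f (u * I)‖ ≤ u ^ k * (C * Real.exp (-c * u)) := by gcongr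
    _ = C * (u ^ k * Real.exp (-c * u)) := by ring
    _ ≤ _ := by gcongr

/-- For modular `f`, `f(τ)(aτ+b)^n` is integrable along the whole positive imaginary axis. -/
theorem integrableOn_period {f : ℂ → ℂ} {c C : ℝ} (hc : 0 < c) {k : ℕ}
    (hhol : DifferentiableOn ℂ f {τ : ℂ | 0 < τ.im})
    (hf : ∀ τ : ℂ, 1 ≤ τ.im → ‖f τ‖ ≤ C * Real.exp (-c * τ.im))
    (hmod : ∀ τ : ℂ, 0 < τ.im → f (-1 / τ) = τ ^ k * f τ) (a b : ℂ) (n : ℕ) :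
    IntegrableOn (fun t : ℝ => f (0 + t * I) * (a * (0 + t * I) + b) ^ n * I) (Ioi 0) := by
  rw [← Ioc_union_Ioi_eq_Ioi zero_le_one]
  refine IntegrableOn.union ?_ (integrableOn_vertical hc hhol hf a b n le_rfl (by simp))
  refine IntegrableOn.of_bound (C := C * (k.factorial / c ^ k) * (‖a‖ + ‖b‖) ^ n)
    measure_Ioc_lt_top ?_ ?_
  · refine ContinuousOn.aestronglyMeasurable ?_ measurableSet_Ioc
    refine ((hhol.continuousOn.comp (by fun_prop) fun t ht => ?_).mul (by fun_prop)).mul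
      (by fun_prop)
    simpa using ht.1
  · refine (ae_restrict_mem measurableSet_Ioc).mono fun t ht => ?_
    have h1 := norm_le_of_modular hc hf hmod ht.1 ht.2
    have h2 : ‖a * (t * I) + b‖ ≤ ‖a‖ + ‖b‖ := by
      refine (norm_add_le _ _).trans ?_
      rw [norm_mul, norm_mul, norm_I, mul_one, Complex.norm_real, Real.norm_of_nonneg ht.1.le]
      gcongr
      exact mul_le_of_le_one_right (norm_nonneg a) ht.2
    rw [norm_mul, norm_I, mul_one, norm_mul, norm_pow, zero_add]
    exact mul_le_mul h1 (pow_le_pow_left₀ (norm_nonneg _) h2 n) (by positivity)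
      ((norm_nonneg _).trans h1)




/-- For a cusp form `f` of even weight `k ≥ 4`, the Eichler integral
`F(z) = ∫_{i∞}^z f(τ)(τ-z)^{k-2} dτ` (integrating along the vertical line from `i∞` to
`z`, parametrized by `τ = z + it`) satisfies `F(-1/z) z^{k-2} - F(z) = r_f(z)`, where
`r_f(z) = ∫_0^{i∞} f(τ)(τ-z)^{k-2} dτ` is the period polynomial (the integral along the
positive imaginary axis, `τ = it`). -/
theorem eichler_integral_coboundary (f : ℂ → ℂ) (k : ℕ) (hk : 4 ≤ k) (hke : Even k)
    (hhol : DifferentiableOn ℂ f {τ : ℂ | 0 < τ.im})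
    (hdecay : ∃ c > (0:ℝ), ∃ C : ℝ, ∀ τ : ℂ, 1 ≤ τ.im → ‖f τ‖ ≤ C * Real.exp (-c * τ.im))
    (hmod : ∀ τ : ℂ, 0 < τ.im → f (-1 / τ) = τ ^ k * f τ)
    (F : ℂ → ℂ)
    (hF : ∀ z : ℂ, F z = -∫ t in Ioi (0:ℝ), f (z + t * I) * (t * I) ^ (k - 2) * I) :
    ∀ z : ℂ, 0 < z.im →
      F (-1 / z) * z ^ (k - 2) - F z =
        ∫ t in Ioi (0:ℝ), f (t * I) * (t * I - z) ^ (k - 2) * I := by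
  obtain ⟨c, hc, C, hf⟩ := hdecay
  intro z hz
  obtain ⟨n, rfl⟩ : ∃ n, k = n + 2 := ⟨k - 2, by omega⟩
  have hn : Even n := by simpa [Nat.even_add] using hke
  simp only [Nat.add_sub_cancel] at hF ⊢
  have hz0 : z ≠ 0 := fun h => by simp [h] at hz
  have him : ∀ τ : ℂ, 0 < τ.im → 0 < (-1 / τ).im := fun τ hτ => by
    have h0 : τ ≠ 0 := fun h => by simp [h] at hτ
    rw [show (-1 / τ).im = τ.im / normSq τ by simp [neg_div]]
    exact div_pos hτ (normSq_pos.mpr h0)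
  obtain ⟨G, hG⟩ := exists_hasDerivAt_of_differentiableOn_upperHalfPlane
    (g := fun τ => f τ * (1 * τ + -z) ^ n) (hhol.mul (by fun_prop))
  have hH : ∀ τ : ℂ, 0 < τ.im →
      HasDerivAt (fun τ => G (-1 / τ)) (f τ * (z * τ + 1) ^ n) τ := by
    intro τ hτ
    have h0 : τ ≠ 0 := fun h => by simp [h] at hτ
    have hinv : HasDerivAt (fun τ : ℂ => -1 / τ) (1 / τ ^ 2) τ := by
      convert! (hasDerivAt_inv h0).neg using 1
      · ext x
        simp [neg_div]
      · simp
    convert! (hG _ (him τ hτ)).comp τ hinv using 1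
    have h1 : (1 * (-1 / τ) + -z) = -((z * τ + 1) / τ) := by
      field_simp
      ring
    rw [hmod τ hτ, h1, hn.neg_pow, div_pow]
    field_simp
    ring
  obtain ⟨L, hL⟩ := exists_tendsto_vertical hc hhol hf hG
  obtain ⟨M, hM⟩ := exists_tendsto_vertical hc hhol hf hH
  have hFz : F z = -(L - G z) := by
    rw [hF, ← integral_vertical hc hhol hf hG hz (hL z hz.le)]
    simp
  have hFz' : F (-1 / z) * z ^ n = -(M - G z) := by
    have h1 := integral_vertical hc hhol hf hH (him z hz) (hM _ (him z hz).le)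
    have h2 : -1 / (-1 / z) = z := by field_simp
    rw [h2] at h1
    rw [hF, ← h1, neg_mul, ← integral_mul_const]
    congr 2
    ext t
    have h3 : z * (-1 / z + t * I) + 1 = t * I * z := by
      field_simp
      ring
    rw [h3, mul_pow]
    ring
  have hperiod : ∫ t in Ioi (0 : ℝ), f (t * I) * (t * I - z) ^ n * I = L - M := by
    have hlim : Tendsto (fun t : ℝ => G (0 + t * I)) (𝓝[>] 0) (𝓝 M) := by
      refine ((hM 0 le_rfl).comp tendsto_inv_nhdsGT_zero).congr fun t => ?_
      simp [div_eq_mul_inv, mul_comm]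
    have h1 := integral_Ioi_of_hasDerivAt_of_tendsto
      (f := Function.update (fun t : ℝ => G (0 + t * I)) 0 M) (m := L) (a := 0)
      (f' := fun t : ℝ => f (0 + t * I) * (1 * (0 + t * I) + -z) ^ n * I)
      (by rwa [continuousWithinAt_update_same, Ici_sdiff_left])
      (fun t (ht : 0 < t) =>
        (hasDerivAt_vertical hG (w := 0) (by simpa using ht)).congr_of_eventuallyEq
          ((eventually_ne_nhds ht.ne').mono fun s hs => Function.update_of_ne hs _ _))
      (integrableOn_period hc hhol hf hmod 1 (-z) n)
      ((hL 0 le_rfl).congr' ((eventually_ne_atTop 0).mono fun s hs =>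
        (Function.update_of_ne hs _ _).symm))
    simpa [sub_eq_add_neg] using h1
  rw [hFz, hFz', hperiod]
  ring
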